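/- Let P be a simple polygon and W = {w₁, …, w_k} a witness set of P; assume Vis(u) equals the closure of its interior for every u ∈ W. Suppose the ordering w₁, …, w_k is a perfect elimination ordering of GCon(W), i.e., for each i the vertex w_i is simplicial in the induced subgraph of GCon(W) on W_i = {w_i, …, w_k}. Then for every i ∈ {1, …, k}, the neighbor witness graph GCon(W_i) (defined using NVis(W_i) = P \ ⋃_{j ≥ i} Vis(w_j)) equals the induced subgraph of GCon(W) on W_i: for all distinct u, v ∈ W_i, u and v are adjacent in GCon(W_i) if and only if they are adjacent in GCon(W). -/

import Mathlib

open Set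

noncomputable section

abbrev Plane := EuclideanSpace ℝ (Fin 2)

/-- A simple polygon, given by a cyclic sequence of at least three distinct vertices
whose closed polygonal boundary curve is a Jordan polygon: two edges intersect exactly
when they are consecutive, and then only in their one shared endpoint. -/
structure SimplePolygon where
  n : ℕ
  three_le : 3 ≤ n
  vertex : ℕ → Plane
  periodic : ∀ i, vertex (i + n) = vertex i
  inj : ∀ i < n, ∀ j < n, vertex i = vertex j → i = j
  jordan : ∀ i < n, ∀ j < n, i ≠ j →
    segment ℝ (vertex i) (vertex (i + 1)) ∩ segment ℝ (vertex j) (vertex (j + 1)) =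
      if j = (i + 1) % n then {vertex (i + 1)}
      else if i = (j + 1) % n then {vertex (j + 1)}
      else ∅

namespace SimplePolygon

/-- The boundary curve of the polygon: the union of its edges. -/
def boundary (P : SimplePolygon) : Set Plane :=
  ⋃ i ∈ Finset.range P.n, segment ℝ (P.vertex i) (P.vertex (i + 1))

/-- The polygon as a region: the boundary together with all bounded connected
components of the complement of the boundary. -/
def region (P : SimplePolygon) : Set Plane :=
  P.boundary ∪ {x | x ∉ P.boundary ∧
    Bornology.IsBounded (connectedComponentIn P.boundaryᶜ x)}

/-- Visibility region of a point `p`: all points `q` of the polygon such that the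
closed segment `[p,q]` is contained in the polygon. -/
def Vis (P : SimplePolygon) (p : Plane) : Set Plane :=
  {q | q ∈ P.region ∧ segment ℝ p q ⊆ P.region}

/-- Visibility region of a set. -/
def VisSet (P : SimplePolygon) (S : Set Plane) : Set Plane :=
  ⋃ p ∈ S, P.Vis p

/-- Two points of the polygon are visible to each other if the segment joining them
lies in the polygon. -/
def Visible (P : SimplePolygon) (p q : Plane) : Prop :=
  p ∈ P.region ∧ q ∈ P.region ∧ segment ℝ p q ⊆ P.region

/-- A witness set: a finite set of points of the polygon with pairwise disjoint
visibility regions. -/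
def IsWitnessSet (P : SimplePolygon) (W : Set Plane) : Prop :=
  W.Finite ∧ W ⊆ P.region ∧
    ∀ x ∈ W, ∀ y ∈ W, x ≠ y → P.Vis x ∩ P.Vis y = ∅

/-- The non-visible region of a witness set. -/
def NVis (P : SimplePolygon) (W : Set Plane) : Set Plane :=
  P.region \ ⋃ w ∈ W, P.Vis w

/-- `Vis p` is regular (has no arms) if it equals the closure of its interior. -/
def VisRegular (P : SimplePolygon) (p : Plane) : Prop :=
  P.Vis p = closure (interior (P.Vis p))

/-- A window of `Vis p`: a non-degenerate closed segment contained in the frontier of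
`Vis p` whose intersection with the frontier of the polygon is exactly its two
endpoints, maximal with these properties. -/
def IsWindow (P : SimplePolygon) (p : Plane) (e : Set Plane) : Prop :=
  ∃ a b : Plane, a ≠ b ∧ e = segment ℝ a b ∧
    e ⊆ frontier (P.Vis p) ∧
    e ∩ frontier P.region = {a, b} ∧
    ∀ a' b' : Plane, a' ≠ b' →
      segment ℝ a' b' ⊆ frontier (P.Vis p) →
      segment ℝ a' b' ∩ frontier P.region = {a', b'} →
      e ⊆ segment ℝ a' b' → e = segment ℝ a' b'

/-- `γ` is (the image of) a neighbor witness path between `w` and `w'`. -/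
def IsNWPath (P : SimplePolygon) (W : Set Plane) (w w' : Plane) (γ : Set Plane) : Prop :=
  ∃ f : Path w w', γ = Set.range f ∧ γ ⊆ P.Vis w ∪ P.NVis W ∪ P.Vis w'

/-- Adjacency in the neighbor witness graph `GCon(W)`. -/
def GConAdj (P : SimplePolygon) (W : Set Plane) (w w' : Plane) : Prop :=
  w ∈ W ∧ w' ∈ W ∧ w ≠ w' ∧ ∃ γ : Set Plane, P.IsNWPath W w w' γ

/-- A connected component `NV` of `NVis W` is attached to `Vis w` if the closure of
`NV` intersects `Vis w`. -/
def Attached (P : SimplePolygon) (NV : Set Plane) (w : Plane) : Prop :=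
  (closure NV ∩ P.Vis w).Nonempty

/-- `w` is a simplicial vertex of `GCon(W)`: its neighbors are pairwise adjacent. -/
def Simplicial (P : SimplePolygon) (W : Set Plane) (w : Plane) : Prop :=
  ∀ u v : Plane, P.GConAdj W w u → P.GConAdj W w v → u ≠ v → P.GConAdj W u v

end SimplePolygon

/-- `NV` is a connected component of `S`. -/
def IsCompOf (NV S : Set Plane) : Prop :=
  ∃ x ∈ S, NV = connectedComponentIn S x

namespace SimplePolygon

theorem isClosed_boundary (P : SimplePolygon) : IsClosed P.boundary := by
  refine Set.Finite.isClosed_biUnion (Finset.finite_toSet _) fun i _ => ?_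
  rw [segment_eq_image_lineMap]
  exact (isCompact_Icc.image (by fun_prop)).isClosed

theorem isClosed_region (P : SimplePolygon) : IsClosed P.region := by
  rw [← isOpen_compl_iff, isOpen_iff_mem_nhds]
  intro x hx
  have hxb : x ∈ P.boundaryᶜ := fun h => hx (Or.inl h)
  have hopen : IsOpen (connectedComponentIn P.boundaryᶜ x) :=
    P.isClosed_boundary.isOpen_compl.connectedComponentIn
  filter_upwards [hopen.mem_nhds (mem_connectedComponentIn hxb)] with y hy hyr
  have hyb := connectedComponentIn_subset _ _ hy
  rcases hyr with h | ⟨_, h⟩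
  · exact hyb h
  · rw [← connectedComponentIn_eq hy] at h
    exact hx (Or.inr ⟨hxb, h⟩)

theorem isClosed_vis (P : SimplePolygon) (p : Plane) : IsClosed (P.Vis p) := by
  have h : P.Vis p = P.region ∩
      ⋂ t ∈ Set.Icc (0 : ℝ) 1, (fun q => AffineMap.lineMap p q t) ⁻¹' P.region := by
    ext q
    simp only [Vis, segment_eq_image_lineMap, Set.mem_ofPred_eq, Set.image_subset_iff,
      Set.mem_inter_iff, Set.mem_iInter, Set.mem_preimage]
    rfl
  rw [h]
  refine P.isClosed_region.inter (isClosed_biInter fun t _ => P.isClosed_region.preimage ?_)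
  simp only [AffineMap.lineMap_apply_module]
  fun_prop

theorem segment_subset_vis (P : SimplePolygon) {p q : Plane} (hq : q ∈ P.Vis p) :
    segment ℝ p q ⊆ P.Vis p := fun _ hx =>
  ⟨hq.2 hx, ((convex_segment p q).segment_subset (left_mem_segment ℝ p q) hx).trans hq.2⟩

theorem joinedIn_vis (P : SimplePolygon) {p q : Plane} (hq : q ∈ P.Vis p) :
    JoinedIn (P.Vis p) q p :=
  (JoinedIn.of_segment_subset (P.segment_subset_vis hq)).symm

theorem self_mem_vis (P : SimplePolygon) {p : Plane} (hp : p ∈ P.region) : p ∈ P.Vis p :=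
  ⟨hp, by simpa using hp⟩

theorem gConAdj_iff_joinedIn (P : SimplePolygon) (W : Set Plane) (a b : Plane) :
    P.GConAdj W a b ↔ a ∈ W ∧ b ∈ W ∧ a ≠ b ∧
      JoinedIn (P.Vis a ∪ P.NVis W ∪ P.Vis b) a b := by
  refine and_congr_right fun _ => and_congr_right fun _ => and_congr_right fun _ => ?_
  constructor
  · rintro ⟨_, f, rfl, hf⟩
    exact ⟨f, fun t => hf (Set.mem_range_self t)⟩
  · rintro ⟨f, hf⟩
    exact ⟨_, f, rfl, Set.range_subset_iff.2 hf⟩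

theorem GConAdj.symm {P : SimplePolygon} {W : Set Plane} {a b : Plane}
    (h : P.GConAdj W a b) : P.GConAdj W b a := by
  rw [gConAdj_iff_joinedIn] at h ⊢
  obtain ⟨ha, hb, hab, hj⟩ := h
  refine ⟨hb, ha, hab.symm, hj.symm.mono ?_⟩
  rintro x ((h | h) | h)
  exacts [Or.inr h, Or.inl (Or.inr h), Or.inl (Or.inl h)]

theorem nVis_anti (P : SimplePolygon) {S T : Set Plane} (h : S ⊆ T) : P.NVis T ⊆ P.NVis S :=
  Set.sdiff_subset_sdiff_right (Set.biUnion_subset_biUnion_left h)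

end SimplePolygon

/-- A path ending in a closed set can be cut off at its first point in that set. -/
theorem JoinedIn.exists_first_mem {X : Type*} [TopologicalSpace X] {F A : Set X} {a b : X}
    (h : JoinedIn F a b) (hA : IsClosed A) (hb : b ∈ A) :
    ∃ q ∈ A ∩ F, JoinedIn (F \ A ∪ {q}) a q := by
  obtain ⟨f, hf⟩ := h
  have hcl : IsClosed (f ⁻¹' A) := hA.preimage f.continuous
  obtain ⟨t, ht, hmin⟩ := hcl.isCompact.exists_isLeast ⟨1, by simpa using hb⟩
  refine ⟨f t, ⟨ht, hf t⟩, ?_⟩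
  have hpc : IsPathConnected (f.extend '' Set.Icc (0 : ℝ) t) :=
    ((convex_Icc (0 : ℝ) t).isPathConnected ⟨0, by simp [t.2.1]⟩).image f.continuous_extend
  have hj := hpc.joinedIn a ⟨0, ⟨le_rfl, t.2.1⟩, by simp⟩ (f t)
    ⟨t, ⟨t.2.1, le_rfl⟩, by simp⟩
  refine hj.mono ?_
  rintro _ ⟨s, hs, rfl⟩
  have hs1 : s ∈ Set.Icc (0 : ℝ) 1 := ⟨hs.1, hs.2.trans t.2.2⟩
  rw [f.extend_apply hs1]
  by_cases hsA : f ⟨s, hs1⟩ ∈ A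
  · have : (⟨s, hs1⟩ : unitInterval) = t := le_antisymm hs.2 (hmin hsA)
    exact Or.inr (by rw [this]; rfl)
  · exact Or.inl ⟨hf _, hsA⟩

namespace SimplePolygon

/-- If `a` and `b` become adjacent once the witness `c` is removed, then before the removal
`a` was adjacent to `b` or to `c`. -/
theorem GConAdj.or_of_insert {P : SimplePolygon} {S T : Set Plane} {a b c : Plane}
    (h : P.GConAdj S a b) (hTS : T ⊆ insert c S) (haT : a ∈ T) (hbT : b ∈ T) (hcT : c ∈ T)
    (hac : a ≠ c) (hbr : b ∈ P.region) :
    P.GConAdj T a b ∨ P.GConAdj T a c := by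
  simp only [gConAdj_iff_joinedIn] at h ⊢
  obtain ⟨-, -, hab, hj⟩ := h
  obtain ⟨q, ⟨hqA, -⟩, hq⟩ := hj.exists_first_mem
    ((P.isClosed_vis b).union (P.isClosed_vis c)) (Or.inl (P.self_mem_vis hbr))
  have hsub : ∀ d, q ∈ P.Vis d →
      (P.Vis a ∪ P.NVis S ∪ P.Vis b) \ (P.Vis b ∪ P.Vis c) ∪ {q} ⊆
        P.Vis a ∪ P.NVis T ∪ P.Vis d := by
    rintro d hd x (⟨(hx | hx) | hx, hxA⟩ | rfl)
    · exact Or.inl (Or.inl hx)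
    · refine Or.inl (Or.inr ⟨hx.1, fun hxT => ?_⟩)
      obtain ⟨e, he, hxe⟩ := Set.mem_iUnion₂.1 hxT
      rcases hTS he with rfl | heS
      · exact hxA (Or.inr hxe)
      · exact hx.2 (Set.mem_iUnion₂.2 ⟨e, heS, hxe⟩)
    · exact absurd (Or.inl hx) hxA
    · exact Or.inr hd
  rcases hqA with hd | hd
  · exact Or.inl ⟨haT, hbT, hab, (hq.mono (hsub b hd)).trans
      ((P.joinedIn_vis hd).mono Set.subset_union_right)⟩
  · exact Or.inr ⟨haT, hcT, hac, (hq.mono (hsub c hd)).trans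
      ((P.joinedIn_vis hd).mono Set.subset_union_right)⟩

end SimplePolygon

/-- For a perfect elimination ordering `w 0, …, w (k-1)` of `GCon(W)`,
the neighbor witness graph of each suffix equals the corresponding induced subgraph. -/
theorem gcon_suffix_eq_induced (P : SimplePolygon) (k : ℕ) (w : ℕ → Plane)
    (hinj : ∀ i < k, ∀ j < k, w i = w j → i = j)
    (hW : P.IsWitnessSet (w '' Set.Iio k))
    (hreg : ∀ u ∈ w '' Set.Iio k, P.VisRegular u)
    (hPEO : ∀ i < k, ∀ a ∈ w '' Set.Ico i k, ∀ b ∈ w '' Set.Ico i k,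
      P.GConAdj (w '' Set.Iio k) (w i) a → P.GConAdj (w '' Set.Iio k) (w i) b →
        a ≠ b → P.GConAdj (w '' Set.Iio k) a b) :
    ∀ i < k, ∀ u ∈ w '' Set.Ico i k, ∀ v ∈ w '' Set.Ico i k, u ≠ v →
      (P.GConAdj (w '' Set.Ico i k) u v ↔ P.GConAdj (w '' Set.Iio k) u v) := by
  have hsub : ∀ i, w '' Set.Ico i k ⊆ w '' Set.Iio k := fun i =>
    Set.image_mono fun _ h => h.2
  intro i
  induction i with
  | zero =>
    intro _ u _ v _ _
    rw [show Set.Ico 0 k = Set.Iio k by ext; simp]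
  | succ i ih =>
    intro hi u hu v hv huv
    constructor
    · intro h
      have hik : i < k := by omega
      have hmono : w '' Set.Ico (i + 1) k ⊆ w '' Set.Ico i k :=
        Set.image_mono (Set.Ico_subset_Ico_left (Nat.le_succ i))
      have hwi : w i ∈ w '' Set.Ico i k := ⟨i, ⟨le_rfl, hik⟩, rfl⟩
      have hins : w '' Set.Ico i k ⊆ insert (w i) (w '' Set.Ico (i + 1) k) := by
        rintro _ ⟨j, hj, rfl⟩
        rcases hj.1.eq_or_lt with rfl | hlt
        · exact Or.inl rfl
        · exact Or.inr ⟨j, ⟨hlt, hj.2⟩, rfl⟩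
      have hne : ∀ x ∈ w '' Set.Ico (i + 1) k, x ≠ w i := by
        rintro _ ⟨j, hj, rfl⟩ he
        have := hinj j hj.2 i hik he
        have := hj.1
        omega
      have hu' := hmono hu
      have hv' := hmono hv
      rcases h.or_of_insert hins hu' hv' hwi (hne u hu) (hW.2.1 (hsub _ hv)) with h₁ | h₁
      · exact (ih hik u hu' v hv' huv).1 h₁
      rcases h.symm.or_of_insert hins hv' hu' hwi (hne v hv) (hW.2.1 (hsub _ hu)) with h₂ | h₂
      · exact (ih hik u hu' v hv' huv).1 h₂.symm
      exact hPEO i hik u hu' v hv'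
        ((ih hik _ hwi u hu' (hne u hu).symm).1 h₁.symm)
        ((ih hik _ hwi v hv' (hne v hv).symm).1 h₂.symm) huv
    · intro h
      rw [SimplePolygon.gConAdj_iff_joinedIn] at h ⊢
      exact ⟨hu, hv, huv, h.2.2.2.mono
        (Set.union_subset_union_left _ (Set.union_subset_union_right _ (P.nVis_anti (hsub _))))⟩
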